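/- If f : ℂ^n → ℂ^n is a polynomial system whose zero set is finite and all zeros are regular (invertible Jacobian), then the number of zeros is at most the product of the degrees d₁⋯d_n of the component polynomials (Bézout bound for the 0-dimensional regular case). -/

import Mathlib

open MvPolynomial

lemma bz_deriv {n : ℕ} (p : MvPolynomial (Fin n) ℂ) (z : Fin n → ℂ) :
    HasStrictFDerivAt (fun z : Fin n → ℂ => eval z p)
      (∑ j, eval z (pderiv j p) • (ContinuousLinearMap.proj (R := ℂ) (φ := fun _ : Fin n => ℂ) j)) z := by
  induction p using MvPolynomial.induction_on with
  | C a =>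
    have e : (fun z : Fin n → ℂ => eval z (C a : MvPolynomial (Fin n) ℂ)) = fun _ => a := by
      ext; simp
    rw [e]
    refine (hasStrictFDerivAt_const (𝕜 := ℂ) a z).congr_fderiv ?_
    ext v
    simp
  | add p q hp hq =>
    have h := hp.add hq
    have e : (fun z : Fin n → ℂ => eval z (p + q)) =
        (fun z => eval z p) + fun z => eval z q := by ext; simp
    rw [e]
    refine h.congr_fderiv ?_
    simp only [map_add]
    rw [← Finset.sum_add_distrib]
    exact Finset.sum_congr rfl fun j _ => (add_smul _ _ _).symm
  | mul_X p i hp =>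
    have h := hp.mul (ContinuousLinearMap.hasStrictFDerivAt
      (ContinuousLinearMap.proj (R := ℂ) (φ := fun _ : Fin n => ℂ) i) (x := z))
    have e : (fun z : Fin n → ℂ => eval z (p * X i)) =
        (fun z => eval z p) * fun z => z i := by ext; simp
    rw [e]
    refine h.congr_fderiv ?_
    ext v
    simp only [ContinuousLinearMap.add_apply, ContinuousLinearMap.smul_apply,
      ContinuousLinearMap.sum_apply, ContinuousLinearMap.proj_apply, smul_eq_mul,
      Derivation.leibniz, pderiv_X, map_add, map_mul, eval_X, Pi.single_apply, add_mul,
      Finset.sum_add_distrib, Finset.mul_sum]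
    congr 1
    · rw [Finset.sum_eq_single i]
      · simp
      · intro b _ hb
        simp [hb.symm]
      · simp
    · exact Finset.sum_congr rfl fun j _ => by ring

/-- Zeros persist under the perturbation `f i + t * x i ^ d i`. -/
lemma bz_persist {n : ℕ} (f : Fin n → MvPolynomial (Fin n) ℂ) (d : Fin n → ℕ) (z : Fin n → ℂ)
    (hz : ∀ i, eval z (f i) = 0)
    (hreg : IsUnit (Matrix.of fun i j : Fin n => eval z (pderiv j (f i))))
    (U : Set (Fin n → ℂ)) (hU : U ∈ nhds z) :
    ∀ᶠ t in nhds (0 : ℂ), ∃ w ∈ U, ∀ i, eval w (f i) + t * w i ^ d i = 0 := by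
  set J : (Fin n → ℂ) →L[ℂ] (Fin n → ℂ) := ContinuousLinearMap.pi fun i =>
    ∑ j, eval z (pderiv j (f i)) • (ContinuousLinearMap.proj (R := ℂ) (φ := fun _ : Fin n => ℂ) j)
    with hJ
  let P : ℂ × (Fin n → ℂ) →L[ℂ] ℂ := ContinuousLinearMap.fst ℂ ℂ (Fin n → ℂ)
  let Q : ℂ × (Fin n → ℂ) →L[ℂ] (Fin n → ℂ) := ContinuousLinearMap.snd ℂ ℂ (Fin n → ℂ)
  let Φ : ℂ × (Fin n → ℂ) → ℂ × (Fin n → ℂ) :=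
    fun x => (x.1, fun i => eval x.2 (f i) + x.1 * x.2 i ^ d i)
  have hder : HasStrictFDerivAt Φ
      (P.prod (ContinuousLinearMap.pi fun i =>
        ((ContinuousLinearMap.proj i).comp (J.comp Q)) + (z i ^ d i) • P)) (0, z) := by
    refine HasStrictFDerivAt.prodMk P.hasStrictFDerivAt ?_
    rw [hasStrictFDerivAt_pi]
    intro i
    refine HasStrictFDerivAt.add ?_ ?_
    · have := (bz_deriv (f i) z)
      have h := HasStrictFDerivAt.comp (g := fun z => eval z (f i)) (f := Prod.snd)
        ((0, z) : ℂ × (Fin n → ℂ)) this Q.hasStrictFDerivAt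
      exact h
    · have h1 : HasStrictFDerivAt (fun x : ℂ × (Fin n → ℂ) => x.2 i)
        ((ContinuousLinearMap.proj i).comp Q) ((0, z) : ℂ × (Fin n → ℂ)) :=
          ContinuousLinearMap.hasStrictFDerivAt ((ContinuousLinearMap.proj i).comp Q)
      refine ((P.hasStrictFDerivAt (x := (0, z))).mul (h1.pow (d i))).congr_fderiv ?_
      ext v <;> simp [P]
  have hsurjJ : Function.Surjective J := by
    intro y
    obtain ⟨v, hv⟩ := (Matrix.mulVec_surjective_iff_isUnit.2 hreg) y
    refine ⟨v, ?_⟩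
    rw [← hv]
    ext i
    simp [hJ, Matrix.mulVec, dotProduct]
  have hsurj : (P.prod (ContinuousLinearMap.pi fun i =>
        ((ContinuousLinearMap.proj i).comp (J.comp Q)) + (z i ^ d i) • P)).range = ⊤ := by
    rw [LinearMap.range_eq_top]
    rintro ⟨t, y⟩
    obtain ⟨v, hv⟩ := hsurjJ (fun i => y i - z i ^ d i * t)
    refine ⟨(t, v), ?_⟩
    ext i
    · simp [P]
    · simp [P, Q, hv]
  have hm := hder.map_nhds_eq_of_surj hsurj
  have h0 : Φ (0, z) = (0, 0) := by
    ext i <;> simp [Φ, hz]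
  rw [h0] at hm
  have hV : Φ '' (Prod.snd ⁻¹' U) ∈ nhds ((0 : ℂ), (0 : Fin n → ℂ)) := by
    rw [← hm]
    exact Filter.image_mem_map (continuous_snd.continuousAt.preimage_mem_nhds hU)
  have hc : Filter.Tendsto (fun t : ℂ => (t, (0 : Fin n → ℂ))) (nhds 0) (nhds (0, 0)) :=
    (Continuous.prodMk continuous_id continuous_const).tendsto' _ _ rfl
  filter_upwards [hc hV] with t ht
  obtain ⟨⟨s, w⟩, hw, he⟩ := ht
  simp only [Φ, Prod.mk.injEq] at he
  obtain ⟨rfl, he⟩ := he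
  exact ⟨w, hw, fun i => congrFun he i⟩

lemma bz_interp {n : ℕ} {ι : Type} [Fintype ι] [DecidableEq ι] (w : ι → Fin n → ℂ)
    (hw : Function.Injective w) (j : ι) :
    ∃ p : MvPolynomial (Fin n) ℂ, p.totalDegree ≤ Fintype.card ι ∧ eval (w j) p ≠ 0 ∧
      ∀ k, k ≠ j → eval (w k) p = 0 := by
  have h : ∀ k, ∃ g : MvPolynomial (Fin n) ℂ, g.totalDegree ≤ 1 ∧
      (k ≠ j → eval (w j) g ≠ 0 ∧ eval (w k) g = 0) := by
    intro k
    by_cases hk : k = j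
    · exact ⟨0, by simp, fun h => absurd hk h⟩
    · obtain ⟨i, hi⟩ := Function.ne_iff.1 (hw.ne hk)
      refine ⟨X i - C (w k i), (totalDegree_sub_C_le _ _).trans (by simp), fun _ => ⟨?_, by simp⟩⟩
      simpa [sub_eq_zero] using hi.symm
  choose g hg1 hg using h
  refine ⟨∏ k ∈ Finset.univ.erase j, g k, ?_, ?_, ?_⟩
  · refine (totalDegree_finsetProd _ _).trans ?_
    refine (Finset.sum_le_card_nsmul _ _ 1 fun k _ => hg1 k).trans ?_
    simp
  · rw [map_prod, Finset.prod_ne_zero_iff]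
    intro k hk
    exact (hg k (Finset.ne_of_mem_erase hk)).1
  · intro k hk
    rw [map_prod]
    exact Finset.prod_eq_zero (Finset.mem_erase.2 ⟨hk, Finset.mem_univ k⟩) (hg k hk).2

open Classical in
lemma bz_count {n : ℕ} (f : Fin n → MvPolynomial (Fin n) ℂ) (ι : Type) [Fintype ι] :
    ∃ S : Set ℂ, S.Finite ∧ ∀ t ∉ S, ∀ w : ι → Fin n → ℂ, Function.Injective w →
      (∀ j i, eval (w j) (f i) + t * w j i ^ (f i).totalDegree = 0) →
      Fintype.card ι ≤ ∏ i, (f i).totalDegree := by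
  let V := restrictTotalDegree (Fin n) ℂ (Fintype.card ι)
  let b : (Fin n →₀ ℕ) → MvPolynomial (Fin n) ℂ := fun a =>
    if h : ∃ i, (f i).totalDegree ≤ a i then
      monomial (a - Finsupp.single h.choose (f h.choose).totalDegree) 1 * f h.choose
    else 0
  let B : MvPolynomial (Fin n) ℂ →ₗ[ℂ] MvPolynomial (Fin n) ℂ :=
    (basisMonomials (Fin n) ℂ).constr ℂ b
  have hBm : ∀ a, B (monomial a 1) = b a := by
    intro a
    have := (basisMonomials (Fin n) ℂ).constr_basis ℂ b a
    simpa using this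
  have hspan : V = Submodule.span ℂ ((monomial · 1) '' {a : Fin n →₀ ℕ | a.degree ≤ Fintype.card ι}) := by
    rw [← restrictSupport_eq_span]
    rfl
  have hdeg : ∀ a : Fin n →₀ ℕ, a.degree ≤ Fintype.card ι → b a ∈ V := by
    intro a ha
    rw [mem_restrictTotalDegree]
    by_cases h : ∃ i, (f i).totalDegree ≤ a i
    · simp only [b, dif_pos h]
      have h2 := h.choose_spec
      set i := h.choose
      refine (totalDegree_mul _ _).trans ?_
      refine (Nat.add_le_add_right (totalDegree_monomial_le _ _) _).trans ?_
      have h3 : a - Finsupp.single i (f i).totalDegree + Finsupp.single i (f i).totalDegree = a :=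
        tsub_add_cancel_of_le (by simpa using h2)
      have h4 := congrArg Finsupp.degree h3
      simp only [map_add, Finsupp.degree_single] at h4
      change Finsupp.degree _ + _ ≤ _
      omega
    · simp [b, dif_neg h]
  have hBV : ∀ p ∈ V, B p ∈ V := by
    intro p hp
    have : V ≤ V.comap B := by
      conv_lhs => rw [hspan]
      rw [Submodule.span_le]
      rintro _ ⟨a, ha, rfl⟩
      simpa [hBm] using hdeg a ha
    exact this hp
  let T : Module.End ℂ V := B.restrict hBV
  refine ⟨(fun t => -t) ⁻¹' spectrum ℂ T,
    (Module.End.finite_spectrum T).preimage neg_injective.injOn, ?_⟩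
  intro t ht w hw hz
  have hu : IsUnit (algebraMap ℂ (Module.End ℂ V) (-t) - T) := by
    simpa [spectrum.mem_iff] using ht
  have hTs : Function.Surjective (algebraMap ℂ (Module.End ℂ V) (-t) - T) :=
    ((Module.End.isUnit_iff _).1 hu).2
  let E : MvPolynomial (Fin n) ℂ →ₗ[ℂ] (ι → ℂ) := LinearMap.pi fun j => (aeval (w j)).toLinearMap
  have hE : ∀ p j, E p j = eval (w j) p := fun p j => by simp [E, aeval_eq_eval]
  let R : Type := ∀ i : Fin n, Fin (f i).totalDegree
  let m : R → (ι → ℂ) := fun r => E (monomial (Finsupp.equivFunOnFinite.symm fun i => (r i : ℕ)) 1)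
  have hker : ∀ p ∈ V, E (t • p + B p) ∈ Submodule.span ℂ (Set.range m) := by
    intro p hp
    have : V ≤ (Submodule.span ℂ (Set.range m)).comap (E.comp (t • LinearMap.id + B)) := by
      rw [hspan, Submodule.span_le]
      rintro _ ⟨a, ha, rfl⟩
      by_cases h : ∃ i, (f i).totalDegree ≤ a i
      · suffices h0 : (E.comp (t • LinearMap.id + B)) (monomial a 1) = 0 by
          simp only [SetLike.mem_coe, Submodule.mem_comap]
          rw [h0]
          exact Submodule.zero_mem _
        ext j
        simp only [LinearMap.comp_apply, LinearMap.add_apply, LinearMap.smul_apply,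
          LinearMap.id_apply, hBm, hE, b, dif_pos h]
        have h2 := h.choose_spec
        set i := h.choose
        have h3 : a - Finsupp.single i (f i).totalDegree + Finsupp.single i (f i).totalDegree = a :=
          tsub_add_cancel_of_le (by simpa using h2)
        have h4 : (monomial a (1 : ℂ)) = monomial (a - Finsupp.single i (f i).totalDegree) 1 *
            X i ^ (f i).totalDegree := by
          rw [X_pow_eq_monomial, monomial_mul, h3, one_mul]
        rw [h4]
        simp only [map_add, map_mul, smul_eval, map_pow, eval_X, Pi.zero_apply]
        linear_combination (eval (w j) (monomial (a - Finsupp.single i (f i).totalDegree) 1)) * hz j i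
      · simp only [SetLike.mem_coe, Submodule.mem_comap, LinearMap.comp_apply, LinearMap.add_apply,
          LinearMap.smul_apply, LinearMap.id_apply, hBm, b, dif_neg h, add_zero, map_smul]
        push Not at h
        refine Submodule.smul_mem _ _ (Submodule.subset_span ⟨fun i => ⟨a i, h i⟩, ?_⟩)
        simp only [m]
        congr 2
        ext i
        simp
    exact this hp
  have htop : Submodule.span ℂ (Set.range m) = ⊤ := by
    rw [eq_top_iff, ← (Pi.basisFun ℂ ι).span_eq, Submodule.span_le]
    rintro _ ⟨j, rfl⟩
    obtain ⟨p, hp, hpj, hpk⟩ := bz_interp w hw j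
    obtain ⟨q, hq⟩ := hTs ⟨p, (mem_restrictTotalDegree _ _ _).2 hp⟩
    have hq' : -(t • (q : MvPolynomial (Fin n) ℂ) + B q) = p := by
      have := congrArg Subtype.val hq
      refine Eq.trans ?_ this
      simp [T, Module.algebraMap_end_apply]
      try ring
    have h1 := hker q q.2
    have h2 : E p ∈ Submodule.span ℂ (Set.range m) := by
      rw [← hq', map_neg]
      exact Submodule.neg_mem _ h1
    have h3 : (Pi.basisFun ℂ ι) j = (eval (w j) p)⁻¹ • E p := by
      ext k
      rw [Pi.smul_apply, hE]
      by_cases hk : k = j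
      · subst hk; simp [hpj]
      · simp [hk, hpk k hk]
    rw [h3]
    exact Submodule.smul_mem _ _ h2
  have hc := finrank_range_le_card (R := ℂ) m
  rw [Set.finrank, htop, finrank_top, Module.finrank_fintype_fun_eq_card] at hc
  simpa [R] using hc

/-- Bézout bound, 0-dimensional regular case: a polynomial system
`f : ℂⁿ → ℂⁿ` with finitely many zeros, all regular (invertible Jacobian),
has at most `d₁⋯d_n` zeros, where `dᵢ = deg fᵢ`. -/
theorem bezout_bound_regular (n : ℕ) (f : Fin n → MvPolynomial (Fin n) ℂ)
    (hfin : {z : Fin n → ℂ | ∀ i, eval z (f i) = 0}.Finite)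
    (hreg : ∀ z ∈ {z : Fin n → ℂ | ∀ i, eval z (f i) = 0},
      IsUnit (Matrix.of fun i j : Fin n => eval z (pderiv j (f i)))) :
    Nat.card {z : Fin n → ℂ | ∀ i, eval z (f i) = 0}
      ≤ ∏ i, (f i).totalDegree := by
  have := hfin.fintype
  obtain ⟨S, hS, hcount⟩ := bz_count f {z : Fin n → ℂ | ∀ i, eval z (f i) = 0}
  obtain ⟨U, hU, hdisj⟩ := hfin.t2_separation
  have h1 : ∀ᶠ t in nhds (0 : ℂ), ∀ z : {z : Fin n → ℂ | ∀ i, eval z (f i) = 0},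
      ∃ w ∈ U z, ∀ i, eval w (f i) + t * w i ^ (f i).totalDegree = 0 := by
    rw [Filter.eventually_all]
    intro z
    exact bz_persist f _ z z.2 (hreg z z.2) _ ((hU z).2.mem_nhds (hU z).1)
  have h2 : ∀ᶠ t in nhdsWithin (0 : ℂ) {0}ᶜ, t ∉ S := by
    have := (hS.subset (Set.sdiff_subset (t := {0}))).isClosed.isOpen_compl.mem_nhds
      (x := (0 : ℂ)) (by simp)
    filter_upwards [mem_nhdsWithin_of_mem_nhds this, self_mem_nhdsWithin] with t ht h0 hts
    exact ht ⟨hts, h0⟩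
  obtain ⟨t, ht1, ht2⟩ := ((h1.filter_mono nhdsWithin_le_nhds).and h2).exists
  choose w hwU hw using ht1
  rw [Nat.card_eq_fintype_card]
  refine hcount t ht2 w ?_ hw
  intro a b hab
  by_contra hne
  have := hdisj a.2 b.2 (fun h => hne (Subtype.ext h))
  exact Set.disjoint_left.1 this (hwU a) (hab ▸ hwU b)
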